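/- arXiv:2506.04791 — 5 statements merged into one kernel-verified Lean document; each statement's English description precedes it below -/
import Mathlib

section
/- Let n ≥ 1, let k q : Fin n → ℕ be positive sizes, let λ l : Fin (k l) → ℂ and μ l : Fin (q l) → ℂ satisfy μ l i ≠ λ l j for all l, i, j, let H : (Fin n → ℂ) → ℂ, and let c : (∀ l, Fin (k l)) → ℂ. Then c lies in the right null space of the n-D Loewner matrix L (i.e. L.mulVec c = 0) if and only if for every row multi-index i one has v i · D(μ(i)) = N(μ(i)), where D and N are the Lagrangian denominator and numerator built from λ, w, c and μ(i) denotes the point (fun l => μ l (i l)). In particular, if L.mulVec c = 0 and D(μ(i)) ≠ 0 for every i, then the multivariate Lagrangian (barycentric) form G_lag = N/D interpolates all the row data: G_lag(μ(i)) = v i for every i. -/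
/-- `c` is a right null vector of the n-D Loewner matrix iff
`v i * D(μ(i)) = N(μ(i))` for all row multi-indices `i`; and in that case, if the
barycentric denominator does not vanish at any row point, the Lagrangian form
`N/D` interpolates all row data. -/
theorem loewner_nullspace_iff_interpolation
    (n : ℕ) (hn : 1 ≤ n) (k q : Fin n → ℕ)
    (hk : ∀ l, 0 < k l) (hq : ∀ l, 0 < q l)
    (lam : ∀ l, Fin (k l) → ℂ) (mu : ∀ l, Fin (q l) → ℂ)
    (hdisj : ∀ l i j, mu l i ≠ lam l j)
    (H : (Fin n → ℂ) → ℂ)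
    (w : ((l : Fin n) → Fin (k l)) → ℂ)
    (hw : ∀ j, w j = H (fun l => lam l (j l)))
    (v : ((l : Fin n) → Fin (q l)) → ℂ)
    (hv : ∀ i, v i = H (fun l => mu l (i l)))
    (L : Matrix ((l : Fin n) → Fin (q l)) ((l : Fin n) → Fin (k l)) ℂ)
    (hL : ∀ i j, L i j = (v i - w j) / ∏ l, (mu l (i l) - lam l (j l)))
    (c : ((l : Fin n) → Fin (k l)) → ℂ)
    (D N : (Fin n → ℂ) → ℂ)
    (hD : ∀ x, D x = ∑ j, c j / ∏ l, (x l - lam l (j l)))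
    (hN : ∀ x, N x = ∑ j, c j * w j / ∏ l, (x l - lam l (j l))) :
    (L.mulVec c = 0 ↔
      ∀ i : (l : Fin n) → Fin (q l),
        v i * D (fun l => mu l (i l)) = N (fun l => mu l (i l))) ∧
    (L.mulVec c = 0 →
      (∀ i : (l : Fin n) → Fin (q l), D (fun l => mu l (i l)) ≠ 0) →
      ∀ i : (l : Fin n) → Fin (q l),
        N (fun l => mu l (i l)) / D (fun l => mu l (i l)) = v i) := by
  have mulVec_apply (i : (l : Fin n) → Fin (q l)) : L.mulVec c i =
      v i * D (fun l => mu l (i l)) - N (fun l => mu l (i l)) := by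
    rw [hD, hN, Finset.mul_sum, ← Finset.sum_sub_distrib]
    refine Finset.sum_congr rfl fun j _ => ?_
    change L i j * c j = _
    rw [hL]
    ring
  have null_iff : L.mulVec c = 0 ↔ ∀ i : (l : Fin n) → Fin (q l),
      v i * D (fun l => mu l (i l)) = N (fun l => mu l (i l)) := by
    simp only [funext_iff, mulVec_apply, Pi.zero_apply, sub_eq_zero]
  refine ⟨null_iff, fun hc hD0 i => ?_⟩
  rw [← null_iff.mp hc i, mul_div_cancel_right₀ _ (hD0 i)]
end

section
/- Let n ≥ 1 and k : Fin n → ℕ with k l ≥ 1. Let p₁, q₁, p₂, q₂ be multivariate polynomials in MvPolynomial (Fin n) ℂ whose degree in the l-th variable is at most k l − 1 for every l. Let S : Fin n → Finset ℂ be finite sets of sample values with card (S l) ≥ 2 · (k l) − 1 for every l. If p₁(x) · q₂(x) = p₂(x) · q₁(x) for every grid point x : Fin n → ℂ with x l ∈ S l for all l, then p₁ · q₂ = p₂ · q₁ as polynomials; in particular, a rational function with degree at most k l − 1 in each variable in numerator and denominator is uniquely determined (up to a common factor) by its values on such a grid, so the underlying rational function H can be exactly recovered from the tensor data. -/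
/-- Two rational functions with coordinatewise numerator/denominator
degrees at most `k l - 1` that agree on a grid with at least `2 k l - 1` samples
per variable have equal cross products `p₁ q₂ = p₂ q₁` as polynomials, i.e. the
underlying rational function is uniquely recoverable from the tensor data. -/
theorem rational_recovery_from_grid
    (n : ℕ) (hn : 1 ≤ n) (k : Fin n → ℕ) (hk : ∀ l, 1 ≤ k l)
    (p₁ q₁ p₂ q₂ : MvPolynomial (Fin n) ℂ)
    (hp₁ : ∀ l, p₁.degreeOf l ≤ k l - 1)
    (hq₁ : ∀ l, q₁.degreeOf l ≤ k l - 1)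
    (hp₂ : ∀ l, p₂.degreeOf l ≤ k l - 1)
    (hq₂ : ∀ l, q₂.degreeOf l ≤ k l - 1)
    (S : Fin n → Finset ℂ) (hS : ∀ l, 2 * k l - 1 ≤ (S l).card)
    (heq : ∀ x : Fin n → ℂ, (∀ l, x l ∈ S l) →
      MvPolynomial.eval x p₁ * MvPolynomial.eval x q₂ =
        MvPolynomial.eval x p₂ * MvPolynomial.eval x q₁) :
    p₁ * q₂ = p₂ * q₁ := by
  refine sub_eq_zero.mp (MvPolynomial.eq_zero_of_eval_zero_at_prod_finset _ S (fun l => ?_)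
    fun x hx => ?_)
  · have h := MvPolynomial.degreeOf_sub_le l (p₁ * q₂) (p₂ * q₁)
    have h₁ := MvPolynomial.degreeOf_mul_le l p₁ q₂
    have h₂ := MvPolynomial.degreeOf_mul_le l p₂ q₁
    grind
  · rw [map_sub, map_mul, map_mul, heq x hx, sub_self]
end

section
/- (Recursive null-space construction, Theorem 3.1 of the paper.) Let n ≥ 2 and k : Fin n → ℕ with k l ≥ 1, and take q l = k l. Let λ l, μ l : Fin (k l) → ℂ be such that for each l the 2·(k l) numbers λ l (0),…,λ l (k l −1), μ l (0),…, μ l (k l −1) are pairwise distinct. Let p, q be multivariate polynomials in MvPolynomial (Fin n) ℂ with degree in the l-th variable at most k l − 1, with q nonvanishing at every point of the grid ∏_l ({λ l (·)} ∪ {μ l (·)}), and let H(x) = p(x)/q(x). Then there exist a nonzero vector a : Fin (k 0) → ℂ lying in the null space of the 1-D Loewner matrix of the univariate function x ↦ H(x, λ 1 (k 1 −1), …, λ (n−1) (k (n−1) −1)) (built with columns λ 0 and rows μ 0), and for each j₀ : Fin (k 0) a nonzero vector b j₀ lying in the null space of the (n−1)-D Loewner matrix of the function (x₁,…,x_{n−1})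 ↦ H(λ 0 (j₀), x₁, …, x_{n−1}) (built with columns λ 1,…,λ (n−1) and rows μ 1,…,μ (n−1)), such that the assembled vector c defined by c (j₀, j') = a j₀ · (b j₀) j' is nonzero and satisfies L.mulVec c = 0, where L is the n-D Loewner matrix of H with points λ, μ. -/
open Polynomial in
/-- Barycentric interpolation is exact on powers of degree below the number of nodes. -/
theorem sum_nodalWeight_mul_inv_sub_mul_pow {K : Type*} [Field K] {m : ℕ} {v : Fin m → K}
    (hv : Function.Injective v) {x : K} (hx : ∀ j, x ≠ v j) {d : ℕ} (hd : d < m) :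
    ∑ j, Lagrange.nodalWeight Finset.univ v j * (x - v j)⁻¹ * v j ^ d =
      x ^ d * ((Lagrange.nodal Finset.univ v).eval x)⁻¹ := by
  have hN : (Lagrange.nodal Finset.univ v).eval x ≠ 0 := by
    rw [Lagrange.eval_nodal, Finset.prod_ne_zero_iff]
    exact fun j _ => sub_ne_zero.mpr (hx j)
  have h := Lagrange.eval_interpolate_not_at_node (s := Finset.univ) (v := v)
    (fun j => v j ^ d) (x := x) (fun j _ => hx j)
  have hX : (X ^ d : K[X]) = Lagrange.interpolate Finset.univ v fun j => v j ^ d := by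
    have := Lagrange.eq_interpolate (s := Finset.univ) (v := v) (f := (X ^ d : K[X])) hv.injOn
      (by rw [degree_X_pow, Finset.card_univ, Fintype.card_fin]; exact_mod_cast hd)
    simpa using this
  rw [← hX, eval_pow, eval_X] at h
  rw [h]
  field_simp

/-- Tensor-product barycentric interpolation is exact on polynomial functions whose degree in each
variable is below the number of nodes for that variable. -/
theorem sum_prod_nodalWeight_div_sub {K ι σ : Type*} [Field K] [Fintype ι] [DecidableEq ι]
    {k : ι → ℕ} {v : ∀ l, Fin (k l) → K} (hv : ∀ l, Function.Injective (v l))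
    {x : ι → K} (hx : ∀ l j, x l ≠ v l j) (S : Finset σ) (g : σ → K) (e : σ → ι → ℕ)
    (he : ∀ s ∈ S, ∀ l, e s l < k l) :
    ∑ j : (l : ι) → Fin (k l), (∑ s ∈ S, g s * ∏ l, v l (j l) ^ e s l) *
        (∏ l, Lagrange.nodalWeight Finset.univ (v l) (j l)) / ∏ l, (x l - v l (j l)) =
      (∑ s ∈ S, g s * ∏ l, x l ^ e s l) *
        ∏ l, ((Lagrange.nodal Finset.univ (v l)).eval (x l))⁻¹ := by
  simp_rw [Finset.sum_mul, Finset.sum_div]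
  rw [Finset.sum_comm]
  refine Finset.sum_congr rfl fun s hs => ?_
  rw [mul_assoc, ← Finset.prod_mul_distrib, Finset.prod_congr rfl fun l _ =>
    (sum_nodalWeight_mul_inv_sub_mul_pow (hv l) (hx l) (he s hs l)).symm,
    Fintype.prod_sum, Finset.mul_sum]
  refine Finset.sum_congr rfl fun j _ => ?_
  simp_rw [Finset.prod_mul_distrib, Finset.prod_inv_distrib]
  ring

/-- A quadrature rule that is exact, up to a common factor, on numerator and denominator of a
rational function annihilates the corresponding row of its Loewner matrix. -/
theorem sum_loewner_row_eq_zero {K J : Type*} [Field K] [Fintype J] {P Q W D : J → K}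
    {p q C : K} (hQ : ∀ j, Q j ≠ 0) (hq : q ≠ 0)
    (hP_sum : ∑ j, P j * W j / D j = p * C) (hQ_sum : ∑ j, Q j * W j / D j = q * C) :
    ∑ j, (p / q - P j / Q j) / D j * (Q j * W j) = 0 := by
  have h : ∀ j, (p / q - P j / Q j) / D j * (Q j * W j) =
      p / q * (Q j * W j / D j) - P j * W j / D j := fun j => by
    have := hQ j
    rw [div_mul_eq_mul_div, ← mul_assoc, sub_mul, div_mul_cancel₀ _ this]
    ring
  simp_rw [h]
  rw [Finset.sum_sub_distrib, ← Finset.mul_sum, hP_sum, hQ_sum]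
  field_simp
  ring

theorem sum_eval_mul_nodalWeight_div {K ι : Type*} [Field K] [Fintype ι] [DecidableEq ι]
    {k : ι → ℕ} (hk : ∀ l, 1 ≤ k l) {v : ∀ l, Fin (k l) → K}
    (hv : ∀ l, Function.Injective (v l)) {x : ι → K} (hx : ∀ l j, x l ≠ v l j)
    {r : MvPolynomial ι K} (hr : ∀ l, r.degreeOf l ≤ k l - 1) :
    ∑ j : (l : ι) → Fin (k l), MvPolynomial.eval (fun l => v l (j l)) r *
        (∏ l, Lagrange.nodalWeight Finset.univ (v l) (j l)) / ∏ l, (x l - v l (j l)) =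
      MvPolynomial.eval x r *
        ∏ l, ((Lagrange.nodal Finset.univ (v l)).eval (x l))⁻¹ := by
  simp_rw [MvPolynomial.eval_eq']
  refine sum_prod_nodalWeight_div_sub hv hx r.support (fun s => r.coeff s) (fun s l => s l) ?_
  intro s hs l
  have := MvPolynomial.monomial_le_degreeOf l hs
  have := hr l
  have := hk l
  omega

theorem sum_eval_cons_mul_nodalWeight_div {K : Type*} [Field K] {m : ℕ}
    {k : Fin (m + 1) → ℕ} (hk : ∀ l, 1 ≤ k l) {v : ∀ l, Fin (k l) → K}
    (hv : ∀ l, Function.Injective (v l)) (z : K) {x : Fin m → K}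
    (hx : ∀ l j, x l ≠ v l.succ j)
    {r : MvPolynomial (Fin (m + 1)) K} (hr : ∀ l, r.degreeOf l ≤ k l - 1) :
    ∑ j : (l : Fin m) → Fin (k l.succ),
        MvPolynomial.eval (Fin.cons z fun l => v l.succ (j l) : Fin (m + 1) → K) r *
        (∏ l, Lagrange.nodalWeight Finset.univ (v l.succ) (j l)) /
          ∏ l, (x l - v l.succ (j l)) =
      MvPolynomial.eval (Fin.cons z x : Fin (m + 1) → K) r *
        ∏ l, ((Lagrange.nodal Finset.univ (v l.succ)).eval (x l))⁻¹ := by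
  simp_rw [MvPolynomial.eval_eq', Fin.prod_univ_succ, Fin.cons_zero, Fin.cons_succ, ← mul_assoc]
  refine sum_prod_nodalWeight_div_sub (fun l => hv l.succ) hx r.support
    (fun s => r.coeff s * z ^ s 0) (fun s l => s l.succ) ?_
  intro s hs l
  have := MvPolynomial.monomial_le_degreeOf l.succ hs
  have := hr l.succ
  have := hk l.succ
  omega

theorem sum_eval_cons_head_mul_nodalWeight_div {K : Type*} [Field K] {m d : ℕ} (hd : 1 ≤ d)
    {v : Fin d → K} (hv : Function.Injective v) {x : K} (hx : ∀ j, x ≠ v j) (y : Fin m → K)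
    {r : MvPolynomial (Fin (m + 1)) K} (hr : r.degreeOf 0 ≤ d - 1) :
    ∑ j, MvPolynomial.eval (Fin.cons (v j) y : Fin (m + 1) → K) r *
        Lagrange.nodalWeight Finset.univ v j / (x - v j) =
      MvPolynomial.eval (Fin.cons x y : Fin (m + 1) → K) r *
        ((Lagrange.nodal Finset.univ v).eval x)⁻¹ := by
  simp_rw [MvPolynomial.eval_eq', Fin.prod_univ_succ, Fin.cons_zero, Fin.cons_succ,
    Finset.sum_mul, Finset.sum_div]
  rw [Finset.sum_comm]
  refine Finset.sum_congr rfl fun s hs => ?_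
  have hs0 : s 0 < d := by
    have := MvPolynomial.monomial_le_degreeOf 0 hs
    omega
  rw [mul_assoc, mul_right_comm, ← sum_nodalWeight_mul_inv_sub_mul_pow hv hx hs0,
    Finset.sum_mul, Finset.mul_sum]
  refine Finset.sum_congr rfl fun j _ => ?_
  ring

/-- recursive null-space construction: for a rational `H = p/q` of
coordinatewise degree at most `k l - 1`, the null space of the n-D Loewner matrix
is obtained by assembling a null vector `a` of one 1-D Loewner matrix (in the
first variable, with the other variables frozen at the last column points) with
null vectors `b j₀` of `(n-1)`-D Loewner matrices (with the first variable frozen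
at `λ 0 (j₀)`), via `c (j₀, j') = a j₀ * (b j₀) j'`. -/
theorem recursive_nullspace_construction
    (n : ℕ) (hn : 2 ≤ n) (k : Fin n → ℕ) (hk : ∀ l, 1 ≤ k l)
    (lam mu : ∀ l, Fin (k l) → ℂ)
    (hlam : ∀ l, Function.Injective (lam l))
    (hmu : ∀ l, Function.Injective (mu l))
    (hlm : ∀ l i j, mu l i ≠ lam l j)
    (p q : MvPolynomial (Fin n) ℂ)
    (hp : ∀ l, p.degreeOf l ≤ k l - 1)
    (hq : ∀ l, q.degreeOf l ≤ k l - 1)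
    (hq0 : ∀ x : Fin n → ℂ,
      (∀ l, (∃ j, x l = lam l j) ∨ (∃ i, x l = mu l i)) →
      MvPolynomial.eval x q ≠ 0)
    (H : (Fin n → ℂ) → ℂ)
    (hH : ∀ x, H x = MvPolynomial.eval x p / MvPolynomial.eval x q)
    (i0 : Fin n) (hi0 : (i0 : ℕ) = 0)
    (emb : Fin (n - 1) → Fin n) (hemb : ∀ l, (emb l : ℕ) = (l : ℕ) + 1)
    (lst : ∀ l, Fin (k l)) (hlst : ∀ l, (lst l : ℕ) = k l - 1)
    (P : ℂ → (Fin (n - 1) → ℂ) → (Fin n → ℂ))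
    (hP0 : ∀ z y, P z y i0 = z)
    (hPe : ∀ z y l, P z y (emb l) = y l) :
    ∃ (a : Fin (k i0) → ℂ)
      (b : Fin (k i0) → (((l : Fin (n - 1)) → Fin (k (emb l))) → ℂ)),
      a ≠ 0 ∧
      (Matrix.of fun i j : Fin (k i0) =>
          (H (P (mu i0 i) fun l => lam (emb l) (lst (emb l))) -
            H (P (lam i0 j) fun l => lam (emb l) (lst (emb l)))) /
          (mu i0 i - lam i0 j)).mulVec a = 0 ∧
      (∀ j₀ : Fin (k i0),
        b j₀ ≠ 0 ∧
        (Matrix.of fun i' j' : (l : Fin (n - 1)) → Fin (k (emb l)) =>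
            (H (P (lam i0 j₀) fun l => mu (emb l) (i' l)) -
              H (P (lam i0 j₀) fun l => lam (emb l) (j' l))) /
            ∏ l, (mu (emb l) (i' l) - lam (emb l) (j' l))).mulVec (b j₀) = 0) ∧
      (fun j : (l : Fin n) → Fin (k l) =>
          a (j i0) * b (j i0) fun l => j (emb l)) ≠ 0 ∧
      (Matrix.of fun i j : (l : Fin n) → Fin (k l) =>
          (H (fun l => mu l (i l)) - H (fun l => lam l (j l))) /
          ∏ l, (mu l (i l) - lam l (j l))).mulVec
        (fun j => a (j i0) * b (j i0) fun l => j (emb l)) = 0 := by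
  obtain ⟨m, rfl⟩ : ∃ m, n = m + 1 := ⟨n - 1, by omega⟩
  obtain rfl : i0 = 0 := Fin.ext hi0
  obtain rfl : emb = Fin.succ := funext fun l => Fin.ext (hemb l)
  obtain rfl : P = fun z (y : Fin m → ℂ) => (Fin.cons z y : Fin (m + 1) → ℂ) := by
    funext z y l
    refine Fin.cases ?_ (fun l => ?_) l
    · exact hP0 z y
    · exact hPe z y l
  obtain rfl : H = fun x => MvPolynomial.eval x p / MvPolynomial.eval x q := funext hH
  have hcons (z : ℂ) (y : Fin m → ℂ) (hz : (∃ j, z = lam 0 j) ∨ ∃ i, z = mu 0 i)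
      (hy : ∀ l, (∃ j, y l = lam l.succ j) ∨ ∃ i, y l = mu l.succ i) :
      MvPolynomial.eval (Fin.cons z y : Fin (m + 1) → ℂ) q ≠ 0 :=
    hq0 _ (Fin.cases hz hy)
  have hw (l) (j : Fin (k l)) : Lagrange.nodalWeight Finset.univ (lam l) j ≠ 0 :=
    Lagrange.nodalWeight_ne_zero (hlam l).injOn (Finset.mem_univ j)
  have hlast (z : ℂ) (hz : (∃ j, z = lam 0 j) ∨ ∃ i, z = mu 0 i) :
      MvPolynomial.eval
        (Fin.cons z fun l => lam (Fin.succ l) (lst (Fin.succ l)) : Fin (m + 1) → ℂ) q ≠ 0 :=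
    hcons _ _ hz fun l => Or.inl ⟨_, rfl⟩
  let a : Fin (k 0) → ℂ := fun j =>
    MvPolynomial.eval
      (Fin.cons (lam 0 j) fun l => lam (Fin.succ l) (lst (Fin.succ l)) : Fin (m + 1) → ℂ) q *
      Lagrange.nodalWeight Finset.univ (lam 0) j
  let b₀ : Fin (k 0) → ((l : Fin m) → Fin (k l.succ)) → ℂ := fun j₀ j =>
    MvPolynomial.eval (Fin.cons (lam 0 j₀) fun l => lam l.succ (j l) : Fin (m + 1) → ℂ) q *
      ∏ l, Lagrange.nodalWeight Finset.univ (lam (Fin.succ l)) (j l)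
  let t : Fin (k 0) → ℂ := fun j₀ => (MvPolynomial.eval
      (Fin.cons (lam 0 j₀) fun l => lam (Fin.succ l) (lst (Fin.succ l)) : Fin (m + 1) → ℂ) q)⁻¹
  have ha (j) : a j ≠ 0 := mul_ne_zero (hlast _ (Or.inl ⟨j, rfl⟩)) (hw 0 j)
  have hb₀ (j₀ j) : b₀ j₀ j ≠ 0 :=
    mul_ne_zero (hcons _ _ (Or.inl ⟨j₀, rfl⟩) fun l => Or.inl ⟨_, rfl⟩)
      (Finset.prod_ne_zero_iff.mpr fun l _ => hw _ _)
  have ht (j₀) : t j₀ ≠ 0 := inv_ne_zero (hlast _ (Or.inl ⟨j₀, rfl⟩))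
  have hc : (fun j : (l : Fin (m + 1)) → Fin (k l) =>
      a (j 0) * (t (j 0) • b₀ (j 0)) fun l => j l.succ) =
      fun j => MvPolynomial.eval (fun l => lam l (j l)) q *
        ∏ l, Lagrange.nodalWeight Finset.univ (lam l) (j l) := by
    funext j
    have hj : (fun l => lam l (j l)) =
        (Fin.cons (lam 0 (j 0)) fun l => lam l.succ (j l.succ) : Fin (m + 1) → ℂ) :=
      (Fin.cons_self_tail fun l => lam l (j l)).symm
    have := hlast _ (Or.inl ⟨j 0, rfl⟩)
    rw [hj, Fin.prod_univ_succ]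
    simp only [a, b₀, t, Pi.smul_apply, smul_eq_mul]
    field_simp
  refine ⟨a, fun j₀ => t j₀ • b₀ j₀, fun h => ha (lst 0) (congrFun h _), ?_,
    fun j₀ => ⟨fun h => smul_ne_zero (ht j₀) (hb₀ j₀ _) (congrFun h fun l => lst l.succ), ?_⟩,
    fun h => mul_ne_zero (ha (lst 0)) (mul_ne_zero (ht _) (hb₀ _ _)) (congrFun h lst), ?_⟩
  · funext i
    exact sum_loewner_row_eq_zero (fun j => hlast _ (Or.inl ⟨j, rfl⟩))
      (hlast _ (Or.inr ⟨i, rfl⟩))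
      (sum_eval_cons_head_mul_nodalWeight_div (hk 0) (hlam 0) (hlm 0 i) _ (hp 0))
      (sum_eval_cons_head_mul_nodalWeight_div (hk 0) (hlam 0) (hlm 0 i) _ (hq 0))
  · rw [Matrix.mulVec_smul]
    refine smul_eq_zero_of_right _ (funext fun i => ?_)
    exact sum_loewner_row_eq_zero
      (fun j => hcons _ _ (Or.inl ⟨j₀, rfl⟩) fun l => Or.inl ⟨_, rfl⟩)
      (hcons _ _ (Or.inl ⟨j₀, rfl⟩) fun l => Or.inr ⟨_, rfl⟩)
      (sum_eval_cons_mul_nodalWeight_div hk hlam _ (fun l => hlm l.succ (i l)) hp)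
      (sum_eval_cons_mul_nodalWeight_div hk hlam _ (fun l => hlm l.succ (i l)) hq)
  · refine (congrArg _ hc).trans ?_
    funext i
    exact sum_loewner_row_eq_zero
      (fun j => hq0 _ fun l => Or.inl ⟨_, rfl⟩) (hq0 _ fun l => Or.inr ⟨_, rfl⟩)
      (sum_eval_mul_nodalWeight_div hk hlam (fun l => hlm l (i l)) hp)
      (sum_eval_mul_nodalWeight_div hk hlam (fun l => hlm l (i l)) hq)
end

section
/- (Variable decoupling, Theorem 3.2 of the paper.) Let n ≥ 1 and k : Fin n → ℕ with k l ≥ 1, take q l = k l, and let λ l, μ l : Fin (k l) → ℂ be such that for each l the 2·(k l) numbers λ l (·), μ l (·) are pairwise distinct. Let p, q ∈ MvPolynomial (Fin n) ℂ have degree at most k l − 1 in the l-th variable, with q nonvanishing at every point of the grid ∏_l ({λ l (·)} ∪ {μ l (·)}), and let H(x) = p(x)/q(x). Then there exists, for each l, a family γ l assigning to every tuple of earlier column indices (j₀,…,j_{l−1}) a nonzero vector γ l (j₀,…,j_{l−1}) : Fin (k l) → ℂ that lies in the null space of the 1-D Loewner matrix (with columns λ l and rows μ l) of the univariate function obtained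 from H by freezing the m-th variable at λ m (j_m) for m < l and at λ m (k m − 1) for m > l, such that the vector c defined entrywise by the product c j = ∏_{l} (γ l (j₀,…,j_{l−1})) (j l) is nonzero and satisfies L.mulVec c = 0, where L is the n-D Loewner matrix of H with points λ, μ; that is, the null space of the n-D Loewner matrix is achieved by a vector decoupled into products of univariate barycentric coefficient vectors. -/
open Lagrange in
/-- Barycentric form of monomial interpolation at distinct nodes. -/
theorem sum_pow_mul_nodalWeight_div {F : Type*} [Field F] {k : ℕ} {v : Fin k → F}
    (hv : Function.Injective v) {x : F} (hx : ∀ j, x ≠ v j) {d : ℕ} (hd : d < k) :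
    ∑ j, v j ^ d * (nodalWeight Finset.univ v j / (x - v j)) =
      x ^ d * ((nodal Finset.univ v).eval x)⁻¹ := by
  have hω : (nodal Finset.univ v).eval x ≠ 0 := by
    rw [eval_nodal]
    exact Finset.prod_ne_zero_iff.mpr fun j _ => sub_ne_zero.mpr (hx j)
  have h := eq_interpolate_of_eval_eq (s := Finset.univ) (v := v) (f := Polynomial.X ^ d)
    (fun j => v j ^ d) hv.injOn
    (by simpa [Polynomial.degree_X_pow] using hd) (by simp)
  have h' := congrArg (Polynomial.eval x) h
  rw [eval_interpolate_not_at_node _ (fun j _ => hx j)] at h'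
  rw [Polynomial.eval_pow, Polynomial.eval_X] at h'
  rw [h', mul_comm (Polynomial.eval x _), mul_assoc, mul_inv_cancel₀ hω, mul_one]
  exact Finset.sum_congr rfl fun j _ => by rw [div_eq_mul_inv]; ring

/-- Barycentric interpolation of a multivariate polynomial on a product grid. -/
theorem MvPolynomial.sum_eval_mul_prod_nodalWeight_div {F : Type*} [Field F] {n : ℕ}
    {k : Fin n → ℕ} {v : ∀ l, Fin (k l) → F} (hv : ∀ l, Function.Injective (v l))
    {x : Fin n → F} (hx : ∀ l j, x l ≠ v l j) {p : MvPolynomial (Fin n) F}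
    (hp : ∀ l, p.degreeOf l < k l) :
    ∑ j : (∀ l, Fin (k l)), eval (fun l => v l (j l)) p *
        ∏ l, (Lagrange.nodalWeight Finset.univ (v l) (j l) / (x l - v l (j l))) =
      eval x p * ∏ l, ((Lagrange.nodal Finset.univ (v l)).eval (x l))⁻¹ := by
  simp only [eval_eq', Finset.sum_mul]
  rw [Finset.sum_comm]
  refine Finset.sum_congr rfl fun d hd => ?_
  simp only [mul_assoc, ← Finset.mul_sum, ← Finset.prod_mul_distrib]
  congr 1
  rw [← Fintype.prod_sum fun l (a : Fin (k l)) =>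
    v l a ^ d l * (Lagrange.nodalWeight Finset.univ (v l) a / (x l - v l a))]
  exact Finset.prod_congr rfl fun l _ => sum_pow_mul_nodalWeight_div (hv l) (hx l)
    ((monomial_le_degreeOf l hd).trans_lt (hp l))

/-- Barycentric interpolation of a multivariate polynomial in a single variable. -/
theorem MvPolynomial.sum_eval_update_mul_nodalWeight_div {F σ : Type*} [Field F] [Fintype σ]
    [DecidableEq σ] {k : ℕ} {v : Fin k → F} (hv : Function.Injective v)
    {x : F} (hx : ∀ j, x ≠ v j) {p : MvPolynomial σ F} {l : σ} (hp : p.degreeOf l < k)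
    (z : σ → F) :
    ∑ j, eval (Function.update z l (v j)) p *
        (Lagrange.nodalWeight Finset.univ v j / (x - v j)) =
      eval (Function.update z l x) p * ((Lagrange.nodal Finset.univ v).eval x)⁻¹ := by
  have hprod (d : σ →₀ ℕ) (y : F) : ∏ i, Function.update z l y i ^ d i =
      (∏ i ∈ Finset.univ.erase l, z i ^ d i) * y ^ d l := by
    rw [← Finset.prod_erase_mul _ _ (Finset.mem_univ l), Function.update_self]
    congr 1
    exact Finset.prod_congr rfl fun i hi => by
      rw [Function.update_of_ne (Finset.ne_of_mem_erase hi)]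
  simp only [eval_eq', Finset.sum_mul, hprod]
  rw [Finset.sum_comm]
  refine Finset.sum_congr rfl fun d hd => ?_
  simp only [mul_assoc, ← Finset.mul_sum]
  rw [sum_pow_mul_nodalWeight_div hv hx ((monomial_le_degreeOf l hd).trans_lt hp)]

/-- A weight vector reproducing numerator and denominator up to a common factor annihilates
the differences of their quotients. -/
theorem sum_div_sub_div_mul_eq_zero {F ι : Type*} [Field F] [Fintype ι] {a b w : ι → F}
    {A B s : F} (hb : ∀ j, b j ≠ 0) (hB : B ≠ 0) (ha : ∑ j, a j * w j = A * s)
    (hbw : ∑ j, b j * w j = B * s) :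
    ∑ j, (A / B - a j / b j) * (b j * w j) = 0 := by
  have h (j : ι) : (A / B - a j / b j) * (b j * w j) = A / B * (b j * w j) - a j * w j := by
    have := hb j
    field_simp
  simp only [h, Finset.sum_sub_distrib, ← Finset.mul_sum, ha, hbw]
  field_simp
  ring


/-- variable decoupling: for a rational `H = p/q` of coordinatewise
degree at most `k l - 1`, there is for each variable `l` and each tuple of earlier
column indices a nonzero univariate Loewner null vector `γ l t` such that the
entrywise product vector `c j = ∏ l, (γ l (j₀,…,j_{l-1})) (j l)` is a nonzero
null vector of the n-D Loewner matrix. -/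
theorem variable_decoupling_nullspace
    (n : ℕ) (hn : 1 ≤ n) (k : Fin n → ℕ) (hk : ∀ l, 1 ≤ k l)
    (lam mu : ∀ l, Fin (k l) → ℂ)
    (hlam : ∀ l, Function.Injective (lam l))
    (hmu : ∀ l, Function.Injective (mu l))
    (hlm : ∀ l i j, mu l i ≠ lam l j)
    (p q : MvPolynomial (Fin n) ℂ)
    (hp : ∀ l, p.degreeOf l ≤ k l - 1)
    (hq : ∀ l, q.degreeOf l ≤ k l - 1)
    (hq0 : ∀ x : Fin n → ℂ,
      (∀ l, (∃ j, x l = lam l j) ∨ (∃ i, x l = mu l i)) →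
      MvPolynomial.eval x q ≠ 0)
    (H : (Fin n → ℂ) → ℂ)
    (hH : ∀ x, H x = MvPolynomial.eval x p / MvPolynomial.eval x q)
    (lst : ∀ l, Fin (k l)) (hlst : ∀ l, (lst l : ℕ) = k l - 1) :
    ∃ γ : (l : Fin n) → ((m : Fin n) → m < l → Fin (k m)) → Fin (k l) → ℂ,
      (∀ (l : Fin n) (t : (m : Fin n) → m < l → Fin (k m)),
        γ l t ≠ 0 ∧
        (Matrix.of fun i j : Fin (k l) =>
            (H (fun m => if hml : m < l then lam m (t m hml)
                  else if m = l then mu l i else lam m (lst m)) -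
             H (fun m => if hml : m < l then lam m (t m hml)
                  else if m = l then lam l j else lam m (lst m))) /
            (mu l i - lam l j)).mulVec (γ l t) = 0) ∧
      (fun j : (m : Fin n) → Fin (k m) =>
          ∏ l, γ l (fun m _ => j m) (j l)) ≠ 0 ∧
      (Matrix.of fun i j : (m : Fin n) → Fin (k m) =>
          (H (fun l => mu l (i l)) - H (fun l => lam l (j l))) /
          ∏ l, (mu l (i l) - lam l (j l))).mulVec
        (fun j => ∏ l, γ l (fun m _ => j m) (j l)) = 0 := by
  have hp' (l : Fin n) : p.degreeOf l < k l := by have := hp l; have := hk l; omega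
  have hq' (l : Fin n) : q.degreeOf l < k l := by have := hq l; have := hk l; omega
  let W (l : Fin n) : Fin (k l) → ℂ := Lagrange.nodalWeight Finset.univ (lam l)
  have hW (l : Fin n) (j : Fin (k l)) : W l j ≠ 0 :=
    Lagrange.nodalWeight_ne_zero (hlam l).injOn (Finset.mem_univ j)
  let pt (l : Fin n) (t : (m : Fin n) → m < l → Fin (k m)) (x : ℂ) : Fin n → ℂ := fun m =>
    if hml : m < l then lam m (t m hml) else if m = l then x else lam m (lst m)
  have hpt (l t x) : pt l t x = Function.update (pt l t 0) l x := by
    funext m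
    by_cases hm : m = l
    · subst hm; simp [pt]
    · simp [pt, hm]
  have hgrid (l t x) (hx : (∃ j, x = lam l j) ∨ ∃ i, x = mu l i) :
      MvPolynomial.eval (pt l t x) q ≠ 0 := by
    refine hq0 _ fun m => ?_
    by_cases hml : m < l
    · exact Or.inl ⟨t m hml, by simp [pt, hml]⟩
    · by_cases hm : m = l
      · subst hm; simpa [pt] using hx
      · exact Or.inl ⟨lst m, by simp [pt, hml, hm]⟩
  let γ (l : Fin n) (t : (m : Fin n) → m < l → Fin (k m)) (j : Fin (k l)) : ℂ :=
    W l j * (MvPolynomial.eval (pt l t (lam l j)) q /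
      MvPolynomial.eval (pt l t (lam l (lst l))) q)
  have hγ (l t j) : γ l t j ≠ 0 :=
    mul_ne_zero (hW l j) (div_ne_zero (hgrid l t _ (Or.inl ⟨_, rfl⟩))
      (hgrid l t _ (Or.inl ⟨_, rfl⟩)))
  let Q (j : (m : Fin n) → Fin (k m)) (s : ℕ) : ℂ :=
    MvPolynomial.eval (fun m : Fin n => if (m : ℕ) < s then lam m (j m) else lam m (lst m)) q
  have hQ (j s) : Q j s ≠ 0 := by
    refine hq0 _ fun m => Or.inl ?_
    by_cases hm : (m : ℕ) < s
    · exact ⟨j m, by simp [hm]⟩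
    · exact ⟨lst m, by simp [hm]⟩
  let q₀ : ℂ := MvPolynomial.eval (fun m => lam m (lst m)) q
  have hprod (j : (m : Fin n) → Fin (k m)) : ∏ l, γ l (fun m _ => j m) (j l) =
      (∏ l, W l (j l)) * (MvPolynomial.eval (fun m => lam m (j m)) q / q₀) := by
    have hsucc (l : Fin n) :
        MvPolynomial.eval (pt l (fun m _ => j m) (lam l (j l))) q = Q j (l + 1) := by
      congr 2
      funext m
      rcases lt_trichotomy m l with h | rfl | h
      · have : (m : ℕ) < l + 1 := by omega
        simp [pt, h, this]
      · simp [pt]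
      · have : ¬ (m : ℕ) < l + 1 := by omega
        simp [pt, h.not_gt, h.ne', this]
    have hself (l : Fin n) :
        MvPolynomial.eval (pt l (fun m _ => j m) (lam l (lst l))) q = Q j l := by
      congr 2
      funext m
      rcases lt_trichotomy m l with h | rfl | h
      · simp [pt, h]
      · simp [pt]
      · simp [pt, h.not_gt, h.ne']
    simp only [γ, hsucc, hself, Finset.prod_mul_distrib]
    congr 1
    rw [Fin.prod_univ_eq_prod_range (fun s => Q j (s + 1) / Q j s) n]
    have htel (N : ℕ) : ∏ s ∈ Finset.range N, Q j (s + 1) / Q j s = Q j N / Q j 0 := by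
      induction N with
      | zero => simp [div_self (hQ j 0)]
      | succ N ih =>
        rw [Finset.prod_range_succ, ih]
        have := hQ j N
        have := hQ j 0
        field_simp
    rw [htel]
    simp [Q, q₀]
  refine ⟨γ, fun l t => ⟨fun h => hγ l t (lst l) (congrFun h _), ?_⟩, fun h => ?_, ?_⟩
  · funext i
    have hsum (r : MvPolynomial (Fin n) ℂ) (hr : r.degreeOf l < k l) :=
      MvPolynomial.sum_eval_update_mul_nodalWeight_div (hlam l) (hlm l i) hr (pt l t 0)
    simp only [← hpt] at hsum
    have h := sum_div_sub_div_mul_eq_zero (fun j => hgrid l t _ (Or.inl ⟨j, rfl⟩))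
      (hgrid l t _ (Or.inr ⟨i, rfl⟩)) (hsum p (hp' l)) (hsum q (hq' l))
    have h' := congrArg (· / MvPolynomial.eval (pt l t (lam l (lst l))) q) h
    simp only [Finset.sum_div, zero_div] at h'
    rw [Pi.zero_apply, ← h', Matrix.mulVec, dotProduct]
    refine Finset.sum_congr rfl fun j _ => ?_
    simp only [Matrix.of_apply, hH]
    change (MvPolynomial.eval (pt l t (mu l i)) p / MvPolynomial.eval (pt l t (mu l i)) q -
      MvPolynomial.eval (pt l t (lam l j)) p / MvPolynomial.eval (pt l t (lam l j)) q) / _ *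
      (W l j * _) = _
    simp only [div_eq_mul_inv, W]
    ring
  · have h' := congrFun h lst
    exact Finset.prod_ne_zero_iff.mpr (fun l _ => hγ l _ _) h'
  · funext i
    have hsum (r : MvPolynomial (Fin n) ℂ) (hr : ∀ l, r.degreeOf l < k l) :=
      MvPolynomial.sum_eval_mul_prod_nodalWeight_div hlam
        (x := fun l => mu l (i l)) (fun l => hlm l (i l)) hr
    have h := sum_div_sub_div_mul_eq_zero
      (fun j : (m : Fin n) → Fin (k m) => hq0 (fun l => lam l (j l)) fun l => Or.inl ⟨j l, rfl⟩)
      (hq0 (fun l => mu l (i l)) fun l => Or.inr ⟨i l, rfl⟩) (hsum p hp') (hsum q hq')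
    have h' := congrArg (· / q₀) h
    simp only [Finset.sum_div, zero_div] at h'
    rw [Pi.zero_apply, ← h', Matrix.mulVec, dotProduct]
    refine Finset.sum_congr rfl fun j _ => ?_
    simp only [Matrix.of_apply, hH, hprod, Finset.prod_div_distrib, W]
    simp only [div_eq_mul_inv]
    ring
end

section
/- For all natural numbers k ≥ 2 and n ≥ 2, the cascaded worst-case flop count is strictly smaller than the full n-D Loewner cost: ∑_{l=1}^{n} k^{l+2} < (k^n)^3, i.e. the recursive null-space computation taming the curse of dimensionality strictly beats the N^3 cost of the SVD of the full N × N Loewner matrix whenever the number of variables is at least 2. -/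
/-- for naturals `k ≥ 2`, `n ≥ 2`, the cascaded worst-case flop
count is strictly smaller than the full n-D Loewner cost `N³ = (kⁿ)³`. -/
theorem cascaded_beats_full
    (k n : ℕ) (hk : 2 ≤ k) (hn : 2 ≤ n) :
    (∑ l ∈ Finset.Icc 1 n, k ^ (l + 2)) < (k ^ n) ^ 3 := by
  have hgeom : ∑ l ∈ Finset.Icc 1 n, k ^ l < k ^ (n + 1) :=
    Nat.geomSum_lt hk fun l hl => Nat.lt_succ_of_le (Finset.mem_Icc.mp hl).2
  calc ∑ l ∈ Finset.Icc 1 n, k ^ (l + 2)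
      = (∑ l ∈ Finset.Icc 1 n, k ^ l) * k ^ 2 := by simp only [pow_add, Finset.sum_mul]
    _ < k ^ (n + 1) * k ^ 2 := Nat.mul_lt_mul_of_pos_right hgeom (by positivity)
    _ = k ^ (n + 3) := by ring
    _ ≤ k ^ (n * 3) := Nat.pow_le_pow_right (by omega) (by omega)
    _ = (k ^ n) ^ 3 := pow_mul k n 3
end
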